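/- Let G = ℝ^{n+1} and G' = ℝ^{m+1} be Grushin spaces with homogeneous norms ϱ and ϱ̃ and homogeneous dimensions Q = n+2 > Q' = m+2 ≥ 3, let R > 0, and let β, b ∈ ℝ with β < Q − Q' and Q' ≤ b. Then for any radial w ∈ C_{0,rad}^∞(B_R^{Q'}(o') ∖ {o'}) there is a radial u ∈ C_{0,rad}^∞(ℝ^{n+1} ∖ {o}) (and conversely, for any such radial u there is such a radial w) so that ∫_{ℝ^{n+1}} |∇_{ϱ,G} u|^{Q'} / ϱ^β dx dt − ((Q−Q'−β)/Q')^{Q'} ∫_{ℝ^{n+1}} |u|^{Q'} ψ^{Q'/2} / ϱ^{Q'+β} dx dt = (C^{Ω,m}/C^{Ω',m}) · ((Q−Q'−β)/(b−1))^{Q'−1} · [ ∫_{B_R^{Q'}(o')} |∇_{ϱ̃,G'} w|^{Q'} / (ln(R/ϱ̃))^{b−Q'} dy ds − ((b−1)/Q')^{Q'} ∫_{B_R^{Q'}(o')} |w|^{Q'} ψ̃^{Q'/2} / (ϱ̃^{Q'} (ln(R/ϱ̃))^b) dy ds ]. -/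

import Mathlib

open MeasureTheory Real

noncomputable section

/-- Points of the Grushin space `ℝ^{n+1}`. -/
abbrev GPt (n : ℕ) := EuclideanSpace ℝ (Fin n) × ℝ

/-- Homogeneous Grushin norm `ϱ(x,t) = (|x|⁴ + 4t²)^{1/4}`. -/
def gNorm {n : ℕ} (z : GPt n) : ℝ := (‖z.1‖ ^ 4 + 4 * z.2 ^ 2) ^ ((1 : ℝ) / 4)

/-- The geometric term `ψ(x,t) = |x|²/ϱ²` (so that `|∇_G ϱ| = ψ^{1/2}`). -/
def gPsi {n : ℕ} (z : GPt n) : ℝ := ‖z.1‖ ^ 2 / gNorm z ^ 2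

/-- Radial derivative `∂_ϱ u(x,t) = d/ds u(s·x/ϱ, s²·t/ϱ²)` at `s = ϱ(x,t)`. -/
def radialDeriv {n : ℕ} (u : GPt n → ℝ) (z : GPt n) : ℝ :=
  deriv (fun s : ℝ => u ((s / gNorm z) • z.1, (s ^ 2 / gNorm z ^ 2) * z.2)) (gNorm z)

/-- The scaled function `u_R(x,t) = u(R·x/ϱ, R²·t/ϱ²)`. -/
def uScaled {n : ℕ} (R : ℝ) (u : GPt n → ℝ) (z : GPt n) : ℝ :=
  u ((R / gNorm z) • z.1, (R ^ 2 / gNorm z ^ 2) * z.2)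

/-- Radial Grushin operator `L_{ϱ,G} u = ψ(∂_ϱ² u + ((Q−1)/ϱ) ∂_ϱ u)`. -/
def radialLap {n : ℕ} (Q : ℝ) (u : GPt n → ℝ) (z : GPt n) : ℝ :=
  gPsi z * (radialDeriv (radialDeriv u) z + (Q - 1) / gNorm z * radialDeriv u z)

/-- The Grushin operator `L_G u = Δ_x u + |x|² ∂_t² u`. -/
def grushinOp {n : ℕ} (u : GPt n → ℝ) (z : GPt n) : ℝ :=
  (∑ i : Fin n,
      deriv (deriv fun s : ℝ => u (z.1 + s • EuclideanSpace.single i (1 : ℝ), z.2)) 0)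
    + ‖z.1‖ ^ 2 * deriv (deriv fun s : ℝ => u (z.1, z.2 + s)) 0

/-- The first-order operator `T_β(u) = ψ^{1/2}(∂_ϱ u + ((Q−β−2)/(2ϱ)) u)`. -/
def Tweight {n : ℕ} (Q β : ℝ) (u : GPt n → ℝ) (z : GPt n) : ℝ :=
  Real.sqrt (gPsi z) * (radialDeriv u z + (Q - β - 2) / (2 * gNorm z) * u z)

/-- The iterated operator `R_{β,k} = T_β ∘ T_{β+2} ∘ ⋯ ∘ T_{β+2k}`. -/
def Rop {n : ℕ} (Q : ℝ) : ℕ → ℝ → (GPt n → ℝ) → GPt n → ℝ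
  | 0, β, u => Tweight Q β u
  | k + 1, β, u => Tweight Q β (Rop Q k (β + 2) u)

/-- The constants `Λ_k(Q,p,β)`. -/
def Lam (Q p β : ℝ) (k : ℕ) : ℝ :=
  if k = 1 then ((Q - p - β) / p) ^ p
  else ((Q * (p - 1) + β + ((k : ℝ) - 2) * p) * (Q - β - (k : ℝ) * p) / p ^ 2) ^ p

/-- The constant `C_{2l,p,β} = ∏_{i=1}^{l} Λ_{2i}(Q,p,β)`. -/
def Ceven (Q p β : ℝ) (l : ℕ) : ℝ := ∏ i ∈ Finset.range l, Lam Q p β (2 * i + 2)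

/-- The constant `C_{2l+1,p,β} = ∏_{i=0}^{l} Λ_{2i+1}(Q,p,β)`. -/
def Codd (Q p β : ℝ) (l : ℕ) : ℝ := ∏ i ∈ Finset.range (l + 1), Lam Q p β (2 * i + 1)

/-- The constant `A_m = ((Q+m)² + (Q−4−m)²)/4`. -/
def Aconst (Q m : ℝ) : ℝ := ((Q + m) ^ 2 + (Q - 4 - m) ^ 2) / 4

/-- The constants `D_{j,m,β}` given by the iteration
`D_{j,m+1,β} = Λ_{2m+2}(Q,2,β) D_{j−2,m,β} + A_{β+4m} D_{j−1,m,β} + D_{j,m,β}`,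
with `D_{0,0,β} = 1` (and vanishing off-range values). -/
def Dconst (Q β : ℝ) : ℕ → ℤ → ℝ
  | 0, j => if j = 0 then 1 else 0
  | m + 1, j =>
      Lam Q 2 β (2 * m + 2) * Dconst Q β m (j - 2)
        + Aconst Q (β + 4 * (m : ℝ)) * Dconst Q β m (j - 1) + Dconst Q β m j

/-- The constants `B_{j,m,β,k}` given by the iteration
`B_{j,m+1,β,k} = Λ_2(Q,2,β+2k+2) B_{j−2,m,β+4,k} + A_{β+2k+2} B_{j−1,m,β+2,k+1} + B_{j,m,β,k+2}`,
with `B_{0,0,β,k} = 1` (and vanishing off-range values). -/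
def Bconst (Q : ℝ) : ℕ → ℤ → ℝ → ℝ → ℝ
  | 0, j, _, _ => if j = 0 then 1 else 0
  | m + 1, j, β, k =>
      Lam Q 2 (β + 2 * k + 2) 2 * Bconst Q m (j - 2) (β + 4) k
        + Aconst Q (β + 2 * k + 2) * Bconst Q m (j - 1) (β + 2) (k + 1)
        + Bconst Q m j β (k + 2)

/-- Surface measure `ω_n` of the unit sphere in `ℝ^n`. -/
def sphSurface (n : ℕ) : ℝ :=
  n * (volume (Metric.ball (0 : EuclideanSpace ℝ (Fin n)) 1)).toReal

/-- The integral constant `C^{Ω,m} = ω_n ∫_0^π (sin φ)^{(n+m)/2} dφ`. -/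
def COmega (n m : ℕ) : ℝ :=
  sphSurface n * ∫ φ in (0 : ℝ)..π, Real.sin φ ^ (((n : ℝ) + (m : ℝ)) / 2)

/-- The sharp Frank–Seiringer constant `c_p = min_{0<t≤1/2} [(1−t)^p − t^p + p t^{p−1}]`. -/
def cFS (p : ℝ) : ℝ :=
  sInf {y : ℝ | ∃ t : ℝ, 0 < t ∧ t ≤ 1 / 2 ∧ y = (1 - t) ^ p - t ^ p + p * t ^ (p - 1)}

/-- Compactly supported smooth test functions with (closed) support inside `s`. -/
def IsTest {n : ℕ} (s : Set (GPt n)) (u : GPt n → ℝ) : Prop :=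
  ContDiff ℝ (⊤ : ℕ∞) u ∧ HasCompactSupport u ∧ tsupport u ⊆ s

/-- A function on the Grushin space is radial if it depends only on the homogeneous norm. -/
def IsRadial {n : ℕ} (u : GPt n → ℝ) : Prop :=
  ∃ f : ℝ → ℝ, ∀ z, u z = f (gNorm z)

/-- The distance function `d_H(u,R)`. -/
def dH {n : ℕ} (Q p β R : ℝ) (u : GPt n → ℝ) : ℝ :=
  (∫ z : GPt n,
      |u z - R ^ ((Q - p - β) / p) * uScaled R u z * gNorm z ^ (-((Q - p - β) / p))| ^ p *
        gPsi z ^ (p / 2) / (|Real.log (R / gNorm z)| ^ p * gNorm z ^ (p + β))) ^ (1 / p)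

/-- The distance function `d_R(u,k,β)`. -/
def dRdist {n : ℕ} (Q p β R : ℝ) (k : ℕ) (u : GPt n → ℝ) : ℝ :=
  (∫ z : GPt n,
      (|u z| ^ ((p - 2) / 2) * u z -
          |uScaled R u z| ^ ((p - 2) / 2) * uScaled R u z *
            (gNorm z / R) ^ (-((Q - (k : ℝ) * p - β) / 2))) ^ 2 *
        gPsi z ^ (p / 2) /
        (gNorm z ^ ((k : ℝ) * p + β) * Real.log (R / gNorm z) ^ 2)) ^ ((1 : ℝ) / 2)

/-- The distance function `d_C(u,R)`. -/
def dCdist {n : ℕ} (Q p R : ℝ) (u : GPt n → ℝ) : ℝ :=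
  (∫ z in {z : GPt n | gNorm z < 1},
      |u z - Real.log (1 / gNorm z) ^ ((p - 1) / p) * R ^ ((p - 1) / p) *
          uScaled (Real.exp (-1 / R)) u z| ^ p *
        gPsi z ^ (p / 2) /
        (gNorm z ^ Q * Real.log (1 / gNorm z) ^ p *
          |Real.log (R * Real.log (1 / gNorm z))| ^ p)) ^ (1 / p)

/-- The identity relating the subcritical Hardy deficit on `ℝ^{n+1}` and the critical Hardy
deficit on the gauge ball of `ℝ^{m+1}` (for radial functions). -/
def radialHardyIdentity (n m : ℕ) (Q Q' R β b : ℝ)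
    (u : GPt n → ℝ) (w : GPt m → ℝ) : Prop :=
  (∫ z : GPt n, gPsi z ^ (Q' / 2) * |radialDeriv u z| ^ Q' / gNorm z ^ β)
      - ((Q - Q' - β) / Q') ^ Q' *
          ∫ z : GPt n, |u z| ^ Q' * gPsi z ^ (Q' / 2) / gNorm z ^ (Q' + β)
    = COmega n m / COmega m m * ((Q - Q' - β) / (b - 1)) ^ (Q' - 1) *
        ((∫ z in {z : GPt m | gNorm z < R},
            gPsi z ^ (Q' / 2) * |radialDeriv w z| ^ Q' /
              Real.log (R / gNorm z) ^ (b - Q'))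
          - ((b - 1) / Q') ^ Q' *
            ∫ z in {z : GPt m | gNorm z < R},
              |w z| ^ Q' * gPsi z ^ (Q' / 2) /
                (gNorm z ^ Q' * Real.log (R / gNorm z) ^ b))

section

open Set Filter Topology

/-! ### Polar coordinates -/

lemma lintegral_fun_norm_euclidean {n : ℕ} (hn : 1 ≤ n) {f : ℝ → ENNReal} (hf : Measurable f) :
    ∫⁻ x : EuclideanSpace ℝ (Fin n), f ‖x‖ =
      ENNReal.ofReal (sphSurface n) *
        ∫⁻ s in Ioi (0 : ℝ), ENNReal.ofReal (s ^ (n - 1)) * f s := by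
  have : Nonempty (Fin n) := ⟨⟨0, hn⟩⟩
  set μ : Measure (EuclideanSpace ℝ (Fin n)) := volume
  have hsph : μ.toSphere univ = ENNReal.ofReal (sphSurface n) := by
    rw [μ.toSphere_apply_univ, sphSurface, ENNReal.ofReal_mul (Nat.cast_nonneg n),
      ENNReal.ofReal_toReal measure_ball_lt_top.ne]
    simp [μ]
  calc
    ∫⁻ x, f ‖x‖ ∂μ = ∫⁻ x : ({(0)}ᶜ : Set (EuclideanSpace ℝ (Fin n))), f ‖x.1‖
        ∂(μ.comap (↑)) := by
      rw [lintegral_subtype_comap (measurableSet_singleton _).compl fun x ↦ f (‖x‖),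
        restrict_compl_singleton]
    _ = ∫⁻ x, f x.2 ∂μ.toSphere.prod
        (.volumeIoiPow (Module.finrank ℝ (EuclideanSpace ℝ (Fin n)) - 1)) := by
      simpa using μ.measurePreserving_homeomorphUnitSphereProd.lintegral_comp_emb
        (Homeomorph.measurableEmbedding _) (f ∘ Subtype.val ∘ Prod.snd)
    _ = _ := by
      have hm : Measurable fun x : Ioi (0 : ℝ) => f x := hf.comp measurable_subtype_coe
      rw [lintegral_prod (fun x : _ × Ioi (0 : ℝ) => f x.2) (hm.comp measurable_snd).aemeasurable]
      simp only [lintegral_const, hsph]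
      rw [mul_comm, finrank_euclideanSpace_fin]
      congr 1
      rw [Measure.volumeIoiPow, lintegral_withDensity_eq_lintegral_mul _ (by fun_prop) hm]
      simp only [Pi.mul_apply]
      rw [lintegral_subtype_comap measurableSet_Ioi
        fun s : ℝ => ENNReal.ofReal (s ^ (n - 1)) * f s]

lemma lintegral_Ioi_comp_mul_left {k : ℝ} (hk : 0 < k) (g : ℝ → ENNReal) :
    ∫⁻ s in Ioi (0 : ℝ), g s = ∫⁻ r in Ioi (0 : ℝ), ENNReal.ofReal k * g (k * r) := by
  have himg : (fun r => k * r) '' Ioi (0 : ℝ) = Ioi 0 := by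
    rw [Set.image_mul_left_Ioi hk, mul_zero]
  have h := lintegral_image_eq_lintegral_abs_deriv_mul (s := Ioi (0 : ℝ)) (f := fun r => k * r)
    (f' := fun _ => k) measurableSet_Ioi
    (fun x _ => by simpa using ((hasDerivAt_id x).const_mul k).hasDerivWithinAt)
    (fun x _ y _ hxy => mul_left_cancel₀ hk.ne' hxy) g
  rw [himg] at h
  simpa [abs_of_pos hk] using h

lemma lintegral_eq_lintegral_tan {a : ℝ} (ha : 0 < a) (g : ℝ → ENNReal) :
    ∫⁻ t, g t = ∫⁻ θ in Ioo (-(π / 2)) (π / 2),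
      ENNReal.ofReal (a / cos θ ^ 2) * g (a * tan θ) := by
  have himg : (fun θ => a * tan θ) '' Ioo (-(π / 2)) (π / 2) = univ := by
    rw [show (fun θ => a * tan θ) = (fun y => a * y) ∘ tan from rfl, image_comp, image_tan_Ioo]
    exact image_univ_of_surjective (mul_left_surjective₀ ha.ne')
  have h := lintegral_image_eq_lintegral_abs_deriv_mul (s := Ioo (-(π / 2)) (π / 2))
    (f := fun θ => a * tan θ) (f' := fun θ => a * (1 / cos θ ^ 2)) measurableSet_Ioo
    (fun x hx => ((hasDerivAt_tan (cos_pos_of_mem_Ioo hx).ne').const_mul a).hasDerivWithinAt)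
    (fun x hx y hy hxy => injOn_tan hx hy (mul_left_cancel₀ ha.ne' hxy)) g
  rw [himg, setLIntegral_univ] at h
  rw [h]
  refine setLIntegral_congr_fun measurableSet_Ioo fun θ hθ => ?_
  rw [abs_of_nonneg (by positivity), mul_one_div]

lemma gNorm_tan {a θ : ℝ} (ha : 0 < a) (hθ : 0 < cos θ) :
    (a ^ 4 + 4 * (a ^ 2 / 2 * tan θ) ^ 2) ^ ((1 : ℝ) / 4) = a / √(cos θ) := by
  have hd := Real.sq_sqrt hθ.le
  have hd0 : 0 < √(cos θ) := Real.sqrt_pos.2 hθ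
  have h1 : a ^ 4 + 4 * (a ^ 2 / 2 * tan θ) ^ 2 = (a / √(cos θ)) ^ 4 := by
    rw [div_pow, show √(cos θ) ^ 4 = (√(cos θ) ^ 2) ^ 2 by ring, hd, tan_eq_sin_div_cos]
    have := sin_sq_add_cos_sq θ
    field_simp
    linear_combination 4 * this
  rw [h1, ← Real.rpow_natCast, ← Real.rpow_mul (by positivity)]
  norm_num

lemma integral_cos_rpow_eq_sin_rpow (q : ℝ) :
    ∫ θ in Ioo (-(π / 2)) (π / 2), cos θ ^ q = ∫ φ in (0 : ℝ)..π, sin φ ^ q := by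
  rw [← integral_Ioc_eq_integral_Ioo, ← intervalIntegral.integral_of_le (by linarith [pi_pos])]
  have := intervalIntegral.integral_comp_sub_left (fun φ => sin φ ^ q) (π / 2)
    (a := -(π / 2)) (b := π / 2)
  simp only [sin_pi_div_two_sub] at this
  rw [this]
  congr 1 <;> ring

lemma polar_jacobian {c r y : ℝ} (n m : ℕ) (hn : 1 ≤ n) (hc : 0 < c) :
    √c * ((√c * r) ^ (n - 1) * ((√c * r) ^ 2 / 2 / c ^ 2 * (c ^ (((m : ℝ) + 2) / 2) * y))) =
      c ^ (((n : ℝ) + m) / 2) / 2 * (r ^ (n + 1) * y) := by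
  obtain ⟨k, rfl⟩ : ∃ k, n = k + 1 := ⟨n - 1, by omega⟩
  have hd := Real.sq_sqrt hc.le
  have hd0 : 0 < √c := Real.sqrt_pos.2 hc
  have key : ∀ j : ℕ, c ^ ((j : ℝ) / 2) = √c ^ j := fun j => by
    rw [Real.sqrt_eq_rpow, ← Real.rpow_natCast, ← Real.rpow_mul hc.le]
    congr 1; ring
  have h1 := key (m + 2)
  have h2 := key (k + 1 + m)
  push_cast at h1 h2 ⊢
  rw [h1, h2]
  generalize √c = d at *
  subst hd
  field_simp
  ring

lemma lintegral_polar {n : ℕ} (m : ℕ) (hn : 1 ≤ n) {h : ℝ → ℝ} (hh : Measurable h) :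
    ∫⁻ z : GPt n, ENNReal.ofReal (gPsi z ^ (((m : ℝ) + 2) / 2) * h (gNorm z)) =
      ENNReal.ofReal (sphSurface n) *
        ((∫⁻ θ in Ioo (-(π / 2)) (π / 2), ENNReal.ofReal (cos θ ^ (((n : ℝ) + m) / 2) / 2)) *
          ∫⁻ r in Ioi (0 : ℝ), ENNReal.ofReal (r ^ (n + 1) * h r)) := by
  set K : ℝ → ℝ → ENNReal := fun s t => ENNReal.ofReal
    ((s ^ 2 / ((s ^ 4 + 4 * t ^ 2) ^ ((1 : ℝ) / 4)) ^ 2) ^ (((m : ℝ) + 2) / 2) *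
      h ((s ^ 4 + 4 * t ^ 2) ^ ((1 : ℝ) / 4))) with hK
  have hKm : Measurable fun p : ℝ × ℝ => K p.1 p.2 := by
    simp only [hK]
    fun_prop
  have h1 : ∫⁻ z : GPt n, ENNReal.ofReal (gPsi z ^ (((m : ℝ) + 2) / 2) * h (gNorm z)) =
      ∫⁻ x : EuclideanSpace ℝ (Fin n), ∫⁻ t, K ‖x‖ t := by
    rw [Measure.volume_eq_prod]
    refine lintegral_prod (fun z : GPt n => K ‖z.1‖ z.2) ?_
    exact (hKm.comp (measurable_fst.norm.prodMk measurable_snd)).aemeasurable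
  rw [h1, lintegral_fun_norm_euclidean hn (f := fun s => ∫⁻ t, K s t)
    hKm.lintegral_prod_right']
  congr 1
  have h2 : ∀ s ∈ Ioi (0 : ℝ), ENNReal.ofReal (s ^ (n - 1)) * ∫⁻ t, K s t =
      ∫⁻ θ in Ioo (-(π / 2)) (π / 2), ENNReal.ofReal (s ^ (n - 1) *
        (s ^ 2 / 2 / cos θ ^ 2 * (cos θ ^ (((m : ℝ) + 2) / 2) * h (s / √(cos θ))))) := by
    intro s hs
    have hs : 0 < s := hs
    rw [lintegral_eq_lintegral_tan (a := s ^ 2 / 2) (by positivity),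
      ← lintegral_const_mul' _ _ ENNReal.ofReal_ne_top]
    refine setLIntegral_congr_fun measurableSet_Ioo fun θ hθ => ?_
    have hc := cos_pos_of_mem_Ioo hθ
    simp only [hK]
    rw [gNorm_tan hs hc, ← ENNReal.ofReal_mul (by positivity),
      ← ENNReal.ofReal_mul (by positivity), div_pow, Real.sq_sqrt hc.le]
    congr 5
    field_simp
  rw [setLIntegral_congr_fun measurableSet_Ioi h2, lintegral_lintegral_swap (by
    apply Measurable.aemeasurable
    simp only [Function.uncurry_def]
    fun_prop), ← lintegral_mul_const _ (by fun_prop)]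
  refine setLIntegral_congr_fun measurableSet_Ioo fun θ hθ => ?_
  have hc := cos_pos_of_mem_Ioo hθ
  have hd0 : 0 < √(cos θ) := Real.sqrt_pos.2 hc
  rw [lintegral_Ioi_comp_mul_left hd0, ← lintegral_const_mul' _ _ ENNReal.ofReal_ne_top]
  refine setLIntegral_congr_fun measurableSet_Ioi fun r hr => ?_
  rw [← ENNReal.ofReal_mul hd0.le, ← ENNReal.ofReal_mul (by positivity),
    mul_div_cancel_left₀ _ hd0.ne', polar_jacobian n m hn hc]

/-- Integration in polar coordinates of a radial function against `ψ^{(m+2)/2}`. -/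
lemma integral_polar {n : ℕ} (m : ℕ) (hn : 1 ≤ n) {h : ℝ → ℝ} (hh : Measurable h)
    (h0 : ∀ r, 0 ≤ r → 0 ≤ h r) :
    ∫ z : GPt n, gPsi z ^ (((m : ℝ) + 2) / 2) * h (gNorm z) =
      COmega n m / 2 * ∫ r in Ioi (0 : ℝ), r ^ (n + 1) * h r := by
  have hN : ∀ z : GPt n, 0 ≤ gNorm z := fun z => by unfold gNorm; positivity
  have hP : ∀ z : GPt n, 0 ≤ gPsi z := fun z => by unfold gPsi; positivity
  rw [integral_eq_lintegral_of_nonneg_ae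
      (.of_forall fun z => mul_nonneg (rpow_nonneg (hP z) _) (h0 _ (hN z)))
      (by
        apply Measurable.aestronglyMeasurable
        unfold gPsi gNorm
        fun_prop),
    lintegral_polar m hn hh, ENNReal.toReal_mul, ENNReal.toReal_mul,
    ENNReal.toReal_ofReal (by unfold sphSurface; positivity),
    ← integral_eq_lintegral_of_nonneg_ae
      ((ae_restrict_iff' measurableSet_Ioo).2 (.of_forall fun θ hθ =>
        div_nonneg (rpow_nonneg (cos_pos_of_mem_Ioo hθ).le _) zero_le_two))
      (Measurable.aestronglyMeasurable (by fun_prop)),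
    ← integral_eq_lintegral_of_nonneg_ae
      ((ae_restrict_iff' measurableSet_Ioi).2 (.of_forall fun r hr =>
        mul_nonneg (pow_nonneg (le_of_lt hr) _) (h0 r (le_of_lt hr))))
      (by fun_prop),
    integral_div, integral_cos_rpow_eq_sin_rpow, COmega]
  ring

lemma COmega_self_pos {m : ℕ} (hm : 1 ≤ m) : 0 < COmega m m := by
  have h1 : 0 < sphSurface m := by
    have : (0 : ℝ) < m := by exact_mod_cast hm
    exact mul_pos this (ENNReal.toReal_pos (Metric.measure_ball_pos _ _ one_pos).ne'
      measure_ball_lt_top.ne)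
  refine mul_pos h1 ?_
  rw [show ((m : ℝ) + m) / 2 = m by ring]
  simp only [Real.rpow_natCast]
  exact integral_sin_pow_pos m

/-! ### The homogeneous norm and radial functions -/

lemma gNorm_nonneg {n : ℕ} (z : GPt n) : 0 ≤ gNorm z := by unfold gNorm; positivity

lemma gNorm_pow_four {n : ℕ} (z : GPt n) : gNorm z ^ 4 = ‖z.1‖ ^ 4 + 4 * z.2 ^ 2 := by
  rw [gNorm, ← Real.rpow_natCast, ← Real.rpow_mul (by positivity)]
  norm_num

lemma gNorm_eq_of_pow_four {n : ℕ} {z : GPt n} {r : ℝ} (hr : 0 ≤ r)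
    (h : ‖z.1‖ ^ 4 + 4 * z.2 ^ 2 = r ^ 4) : gNorm z = r := by
  rw [← gNorm_pow_four] at h
  exact (pow_left_inj₀ (gNorm_nonneg z) hr (by norm_num)).1 h

lemma gNorm_eq_zero_iff {n : ℕ} {z : GPt n} : gNorm z = 0 ↔ z = 0 := by
  constructor
  · intro h
    have h4 := gNorm_pow_four z
    rw [h] at h4
    have h1 : ‖z.1‖ ^ 4 = 0 := by nlinarith [sq_nonneg z.2, sq_nonneg (‖z.1‖ ^ 2)]
    have h2 : z.2 ^ 2 = 0 := by nlinarith
    exact Prod.ext (norm_eq_zero.1 (pow_eq_zero_iff (by norm_num) |>.1 h1))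
      (pow_eq_zero_iff (by norm_num) |>.1 h2)
  · rintro rfl
    exact gNorm_eq_of_pow_four le_rfl (by simp)

lemma gNorm_pos {n : ℕ} {z : GPt n} (hz : z ≠ 0) : 0 < gNorm z :=
  (gNorm_nonneg z).lt_of_ne' (mt gNorm_eq_zero_iff.1 hz)

lemma continuous_gNorm {n : ℕ} : Continuous (gNorm : GPt n → ℝ) := by
  unfold gNorm
  exact Continuous.rpow_const (by fun_prop) fun _ => Or.inr (by norm_num)

lemma contDiffAt_gNorm {n : ℕ} {z : GPt n} (hz : z ≠ 0) {k : WithTop ℕ∞} :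
    ContDiffAt ℝ k (gNorm : GPt n → ℝ) z := by
  have h4 := gNorm_pow_four z
  have hpos : 0 < gNorm z ^ 4 := pow_pos (gNorm_pos hz) 4
  have : (gNorm : GPt n → ℝ) =
      fun z => ((‖z.1‖ ^ 2) ^ 2 + 4 * z.2 ^ 2) ^ ((1 : ℝ) / 4) := by
    funext z
    rw [gNorm, ← pow_mul]
  rw [this]
  refine ContDiffAt.rpow_const_of_ne ?_ (by rw [← pow_mul, ← h4]; exact hpos.ne')
  have h1 : ContDiffAt ℝ k (fun z : GPt n => ‖z.1‖ ^ 2) z := contDiffAt_fst.norm_sq ℝ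
  exact (h1.pow 2).add (contDiffAt_const.mul (contDiffAt_snd.pow 2))

lemma isCompact_gNorm_preimage {n : ℕ} {K : Set ℝ} (hK : IsCompact K) :
    IsCompact (gNorm ⁻¹' K : Set (GPt n)) := by
  refine Metric.isCompact_of_isClosed_isBounded (hK.isClosed.preimage continuous_gNorm) ?_
  obtain ⟨C, hC⟩ := hK.isBounded.exists_norm_le
  refine isBounded_iff_forall_norm_le.2 ⟨max C (C ^ 2), fun z hz => ?_⟩
  have h0 := gNorm_nonneg z
  have h1 : gNorm z ≤ C := (le_abs_self _).trans (hC _ hz)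
  have h4 : gNorm z ^ 4 ≤ C ^ 4 := pow_le_pow_left₀ h0 h1 4
  rw [gNorm_pow_four] at h4
  have hC0 : 0 ≤ C := h0.trans h1
  rw [Prod.norm_def]
  refine max_le_max ?_ ?_
  · exact (pow_le_pow_iff_left₀ (norm_nonneg _) hC0 (n := 4) (by norm_num)).1
      (by nlinarith [sq_nonneg z.2])
  · rw [Real.norm_eq_abs]
    refine abs_le_of_sq_le_sq ?_ (by positivity)
    nlinarith [sq_nonneg (‖z.1‖ ^ 2), sq_nonneg z.2]

lemma gNorm_dilation {n : ℕ} {z : GPt n} (hz : z ≠ 0) {s : ℝ} (hs : 0 ≤ s) :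
    gNorm ((s / gNorm z) • z.1, (s ^ 2 / gNorm z ^ 2) * z.2) = s := by
  have hr := gNorm_pos hz
  apply gNorm_eq_of_pow_four hs
  simp only [norm_smul, Real.norm_eq_abs, abs_of_nonneg (div_nonneg hs hr.le)]
  have h4 := gNorm_pow_four z
  field_simp
  linear_combination -s ^ 4 * h4

lemma radialDeriv_comp_gNorm {n : ℕ} {f : ℝ → ℝ} (hf : f =ᶠ[𝓝 0] 0) (z : GPt n) :
    radialDeriv (fun z : GPt n => f (gNorm z)) z = deriv f (gNorm z) := by
  rcases eq_or_ne z 0 with rfl | hz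
  · have h0 : gNorm (0 : GPt n) = 0 := gNorm_eq_zero_iff.2 rfl
    rw [h0, hf.deriv_eq]
    simp [radialDeriv]
  · refine Filter.EventuallyEq.deriv_eq ?_
    filter_upwards [eventually_gt_nhds (gNorm_pos hz)] with s hs
    rw [gNorm_dilation hz hs.le]

/-- A smooth radial profile on `ℝ` supported in the compact set `K`. -/
structure IsProfile (K : Set ℝ) (f : ℝ → ℝ) : Prop where
  contDiff : ContDiff ℝ (⊤ : ℕ∞) f
  compact : IsCompact K
  zero_off : ∀ r, r ∉ K → f r = 0

lemma IsProfile.eventuallyEq_zero {K : Set ℝ} {f : ℝ → ℝ} (hf : IsProfile K f) {r : ℝ}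
    (hr : r ∉ K) : f =ᶠ[𝓝 r] 0 := by
  filter_upwards [hf.compact.isClosed.isOpen_compl.mem_nhds hr] with s hs
  exact hf.zero_off s hs

lemma isProfile_indicator {U K : Set ℝ} (hU : IsOpen U) (hK : IsCompact K) (hKU : K ⊆ U)
    {f : ℝ → ℝ} (hf : ContDiffOn ℝ (⊤ : ℕ∞) f U) (h0 : ∀ r ∈ U, r ∉ K → f r = 0) :
    IsProfile K (K.indicator f) := by
  refine ⟨contDiff_iff_contDiffAt.2 fun r => ?_, hK, fun r hr => indicator_of_notMem hr f⟩
  by_cases hr : r ∈ U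
  · refine (hf.contDiffAt (hU.mem_nhds hr)).congr_of_eventuallyEq ?_
    filter_upwards [hU.mem_nhds hr] with s hs
    by_cases hsK : s ∈ K
    · exact indicator_of_mem hsK f
    · rw [indicator_of_notMem hsK, h0 s hs hsK]
  · refine (contDiffAt_const (c := (0 : ℝ))).congr_of_eventuallyEq ?_
    filter_upwards [hK.isClosed.isOpen_compl.mem_nhds fun h => hr (hKU h)] with s hs
    exact indicator_of_notMem hs f

lemma IsProfile.isTest {n : ℕ} {K : Set ℝ} {f : ℝ → ℝ} (hf : IsProfile K f) (hK : K ⊆ Ioi 0)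
    {S : Set (GPt n)} (hS : gNorm ⁻¹' K ⊆ S) : IsTest S fun z : GPt n => f (gNorm z) := by
  have hsupp : tsupport (fun z : GPt n => f (gNorm z)) ⊆ gNorm ⁻¹' K := by
    refine closure_minimal (fun z hz => ?_) (hf.compact.isClosed.preimage continuous_gNorm)
    by_contra h
    exact hz (hf.zero_off _ h)
  refine ⟨contDiff_iff_contDiffAt.2 fun z => ?_,
    (isCompact_gNorm_preimage hf.compact).of_isClosed_subset (isClosed_tsupport _) hsupp,
    hsupp.trans hS⟩
  rcases eq_or_ne z 0 with rfl | hz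
  · refine (contDiffAt_const (c := (0 : ℝ))).congr_of_eventuallyEq ?_
    have h0 : gNorm (0 : GPt n) = 0 := gNorm_eq_zero_iff.2 rfl
    have hz : f =ᶠ[𝓝 (gNorm (0 : GPt n))] 0 := by
      rw [h0]
      exact hf.eventuallyEq_zero fun h => lt_irrefl (0 : ℝ) (hK h)
    exact continuous_gNorm.continuousAt.eventually hz
  · exact hf.contDiff.contDiffAt.comp z (contDiffAt_gNorm hz)

/-- A radial test function supported away from the origin has a smooth profile. -/
lemma exists_profile {n : ℕ} (hn : 1 ≤ n) {S : Set (GPt n)} {u : GPt n → ℝ} (hu : IsTest S u)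
    (hrad : IsRadial u) (hS : (0 : GPt n) ∉ S) :
    ∃ f, IsProfile (gNorm '' tsupport u) f ∧ u = fun z => f (gNorm z) := by
  obtain ⟨hsm, hcpt, hsub⟩ := hu
  obtain ⟨g, hg⟩ := hrad
  set e : EuclideanSpace ℝ (Fin n) := EuclideanSpace.single ⟨0, hn⟩ 1
  have he : ∀ r : ℝ, 0 ≤ r → gNorm ((r • e, 0) : GPt n) = r := fun r hr => by
    apply gNorm_eq_of_pow_four hr
    simp [e, norm_smul, abs_of_nonneg hr]
  set f₀ : ℝ → ℝ := fun r => u (r • e, 0)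
  have hf₀ : ContDiff ℝ (⊤ : ℕ∞) f₀ :=
    hsm.comp ((contDiff_id.smul contDiff_const).prodMk contDiff_const)
  have hz : ∀ z, u z = f₀ (gNorm z) := fun z => by
    simp only [f₀]
    rw [hg, hg, he _ (gNorm_nonneg z)]
  refine ⟨(gNorm '' tsupport u).indicator f₀,
    isProfile_indicator (isOpen_Ioi (a := 0)) (hcpt.isCompact.image continuous_gNorm) ?_
      hf₀.contDiffOn fun r hr hrK => ?_, funext fun z => ?_⟩
  · rintro _ ⟨z, hz, rfl⟩
    exact gNorm_pos fun h => hS (h ▸ hsub hz)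
  · by_contra h
    exact hrK ⟨_, subset_tsupport u h, he r (le_of_lt hr)⟩
  · by_cases h : gNorm z ∈ gNorm '' tsupport u
    · rw [indicator_of_mem h, hz]
    · rw [indicator_of_notMem h]
      exact image_eq_zero_of_notMem_tsupport fun h' => h ⟨z, h', rfl⟩

/-! ### The change of the radial variable -/

/-- The change of variable `r ↦ R exp(-r^{-c})` from `(0,∞)` onto `(0,R)`. -/
def expScale (R c r : ℝ) : ℝ := R * exp (-r ^ (-c))

/-- The inverse `ρ ↦ (ln(R/ρ))^{-1/c}` of `expScale`. -/
def logScale (R c ρ : ℝ) : ℝ := log (R / ρ) ^ (-c⁻¹)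

section Scale

variable {R c : ℝ}

lemma log_div_expScale (hR : 0 < R) (r : ℝ) : log (R / expScale R c r) = r ^ (-c) := by
  rw [expScale, div_mul_cancel_left₀ hR.ne', ← exp_neg, log_exp, neg_neg]

lemma expScale_pos (hR : 0 < R) (r : ℝ) : 0 < expScale R c r := mul_pos hR (exp_pos _)

lemma expScale_mem (hR : 0 < R) {r : ℝ} (hr : 0 < r) : expScale R c r ∈ Ioo 0 R :=
  ⟨expScale_pos hR r, mul_lt_of_lt_one_right hR (by
    rw [exp_lt_one_iff]
    exact neg_lt_zero.2 (rpow_pos_of_pos hr _))⟩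

lemma log_div_pos {ρ : ℝ} (hρ : ρ ∈ Ioo 0 R) : 0 < log (R / ρ) :=
  log_pos ((one_lt_div hρ.1).2 hρ.2)

lemma logScale_pos {ρ : ℝ} (hρ : ρ ∈ Ioo 0 R) : 0 < logScale R c ρ :=
  rpow_pos_of_pos (log_div_pos hρ) _

lemma logScale_expScale (hR : 0 < R) (hc : 0 < c) {r : ℝ} (hr : 0 < r) :
    logScale R c (expScale R c r) = r := by
  rw [logScale, log_div_expScale hR, ← rpow_mul hr.le, neg_mul_neg, mul_inv_cancel₀ hc.ne',
    rpow_one]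

lemma expScale_logScale (hR : 0 < R) (hc : 0 < c) {ρ : ℝ} (hρ : ρ ∈ Ioo 0 R) :
    expScale R c (logScale R c ρ) = ρ := by
  rw [logScale, expScale, ← rpow_mul (log_div_pos hρ).le, neg_mul_neg, inv_mul_cancel₀ hc.ne',
    rpow_one, exp_neg, exp_log (div_pos hR hρ.1), inv_div, mul_div_cancel₀ _ hR.ne']

lemma hasDerivAt_expScale {r : ℝ} (hr : 0 < r) :
    HasDerivAt (expScale R c) (expScale R c r * (c * r ^ (-c - 1))) r := by
  have h := ((hasDerivAt_rpow_const (p := -c) (Or.inl hr.ne')).neg.exp).const_mul R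
  refine h.congr_deriv ?_
  simp only [expScale, Pi.neg_apply]
  ring

lemma contDiffOn_expScale {k : WithTop ℕ∞} : ContDiffOn ℝ k (expScale R c) (Ioi 0) := fun _ hr =>
  (contDiffAt_const.mul (contDiffAt_rpow_const_of_ne (ne_of_gt hr)).neg.exp).contDiffWithinAt

lemma contDiffOn_logScale {k : WithTop ℕ∞} : ContDiffOn ℝ k (logScale R c) (Ioo 0 R) :=
  fun ρ hρ => by
    have h1 : R / ρ ≠ 0 := (div_pos (hρ.1.trans hρ.2) hρ.1).ne'
    exact (ContDiffAt.rpow_const_of_ne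
      ((contDiffAt_const.div contDiffAt_id hρ.1.ne').log h1) (log_div_pos hρ).ne').contDiffWithinAt

lemma expScale_image (hR : 0 < R) (hc : 0 < c) : expScale R c '' Ioi 0 = Ioo 0 R := by
  refine Subset.antisymm ?_ fun ρ hρ => ⟨_, logScale_pos hρ, expScale_logScale hR hc hρ⟩
  rintro _ ⟨r, hr, rfl⟩
  exact expScale_mem hR hr

lemma integral_Ioo_eq_integral_expScale (hR : 0 < R) (hc : 0 < c) (g : ℝ → ℝ) :
    ∫ ρ in Ioo 0 R, g ρ =
      ∫ r in Ioi (0 : ℝ), expScale R c r * (c * r ^ (-c - 1)) * g (expScale R c r) := by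
  have h := integral_image_eq_integral_abs_deriv_smul (s := Ioi (0 : ℝ)) (f := expScale R c)
    measurableSet_Ioi (fun r hr => (hasDerivAt_expScale hr).hasDerivWithinAt)
    (fun r hr s hs h => by
      rw [← logScale_expScale hR hc hr, h, logScale_expScale hR hc hs]) g
  rw [expScale_image hR hc] at h
  rw [h]
  refine setIntegral_congr_fun measurableSet_Ioi fun r hr => ?_
  have hr : 0 < r := hr
  have := expScale_pos (c := c) hR r
  simp only [smul_eq_mul]
  rw [abs_of_nonneg (by positivity)]

end Scale

section Profiles

variable {K L : Set ℝ} {F G : ℝ → ℝ} {R c : ℝ}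

/-- Transplanting a profile on `(0,R)` to `(0,∞)`. -/
lemma IsProfile.exists_comp_expScale (hG : IsProfile L G) (hL : L ⊆ Ioo 0 R) (hR : 0 < R)
    (hc : 0 < c) :
    ∃ K F, K ⊆ Ioi 0 ∧ IsProfile K F ∧ ∀ r, 0 < r → F r = G (expScale R c r) := by
  have h0 : ∀ r ∈ Ioi (0 : ℝ), r ∉ logScale R c '' L → G (expScale R c r) = 0 :=
    fun r hr hrK => hG.zero_off _ fun h => hrK ⟨_, h, logScale_expScale hR hc hr⟩
  have hK : logScale R c '' L ⊆ Ioi 0 := by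
    rintro _ ⟨ρ, hρ, rfl⟩
    exact logScale_pos (hL hρ)
  refine ⟨_, _, hK, isProfile_indicator isOpen_Ioi
    (hG.compact.image_of_continuousOn ((contDiffOn_logScale (k := 0)).continuousOn.mono hL)) hK
    (hG.contDiff.comp_contDiffOn contDiffOn_expScale) h0, fun r hr => ?_⟩
  by_cases h : r ∈ logScale R c '' L
  · rw [indicator_of_mem h, Function.comp_apply]
  · rw [indicator_of_notMem h, h0 r hr h]

/-- Transplanting a profile on `(0,∞)` to `(0,R)`. -/
lemma IsProfile.exists_comp_logScale (hF : IsProfile K F) (hK : K ⊆ Ioi 0) (hR : 0 < R)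
    (hc : 0 < c) :
    ∃ L G, L ⊆ Ioo 0 R ∧ IsProfile L G ∧ ∀ r, 0 < r → F r = G (expScale R c r) := by
  have h0 : ∀ ρ ∈ Ioo 0 R, ρ ∉ expScale R c '' K → F (logScale R c ρ) = 0 :=
    fun ρ hρ hρL => hF.zero_off _ fun h => hρL ⟨_, h, expScale_logScale hR hc hρ⟩
  have hL : expScale R c '' K ⊆ Ioo 0 R := by
    rintro _ ⟨r, hr, rfl⟩
    exact expScale_mem hR (hK hr)
  refine ⟨_, _, hL, isProfile_indicator isOpen_Ioo
    (hF.compact.image_of_continuousOn ((contDiffOn_expScale (k := 0)).continuousOn.mono hK)) hL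
    (hF.contDiff.comp_contDiffOn contDiffOn_logScale) h0, fun r hr => ?_⟩
  by_cases h : expScale R c r ∈ expScale R c '' K
  · rw [indicator_of_mem h, Function.comp_apply, logScale_expScale hR hc hr]
  · have := h0 _ (expScale_mem hR hr) h
    rw [indicator_of_notMem h, ← this, logScale_expScale hR hc hr]

lemma deriv_eq_of_comp_expScale (hG : IsProfile L G)
    (hFG : ∀ r, 0 < r → F r = G (expScale R c r)) {r : ℝ} (hr : 0 < r) :
    deriv F r = deriv G (expScale R c r) * (expScale R c r * (c * r ^ (-c - 1))) := by
  have h : F =ᶠ[𝓝 r] fun r => G (expScale R c r) := by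
    filter_upwards [eventually_gt_nhds hr] with s hs using hFG s hs
  rw [h.deriv_eq]
  have hG' : DifferentiableAt ℝ G (expScale R c r) :=
    hG.contDiff.differentiable (by simp) _
  exact (hG'.hasDerivAt.comp r (hasDerivAt_expScale hr)).deriv

variable {n m : ℕ} {β b p : ℝ}

lemma integral_deriv_profile (hG : IsProfile L G) (hR : 0 < R) (hc : 0 < c)
    (hFG : ∀ r, 0 < r → F r = G (expScale R c r)) (hp : p = m + 2)
    (hcb : c * (b - 1) = n + 2 - p - β) :
    ∫ r in Ioi (0 : ℝ), r ^ (n + 1) * (|deriv F r| ^ p / r ^ β) =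
      c ^ (p - 1) * ∫ ρ in Ioo 0 R, ρ ^ (m + 1) * (|deriv G ρ| ^ p / log (R / ρ) ^ (b - p)) := by
  rw [integral_Ioo_eq_integral_expScale hR hc, ← integral_const_mul]
  refine setIntegral_congr_fun measurableSet_Ioi fun r hr => ?_
  have hr : 0 < r := hr
  have hρ := expScale_pos (c := c) hR r
  rw [deriv_eq_of_comp_expScale hG hFG hr, log_div_expScale hR, abs_mul, abs_mul, abs_mul,
    abs_of_pos hρ, abs_of_pos hc, abs_of_pos (rpow_pos_of_pos hr _),
    mul_rpow (abs_nonneg _) (by positivity), mul_rpow hρ.le (by positivity),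
    mul_rpow hc.le (by positivity), ← rpow_mul hr.le, ← rpow_mul hr.le]
  generalize expScale R c r = ρ at *
  have e1 : ρ ^ p = ρ ^ (m + 2) := by
    rw [hp, ← rpow_natCast]; push_cast; rfl
  have e2 : c ^ p = c ^ (p - 1) * c := by
    rw [← rpow_add_one hc.ne']; congr 1; ring
  have e3 : r ^ (n + 1) * (r ^ ((-c - 1) * p) / r ^ β) =
      r ^ (-c - 1) / r ^ (-c * (b - p)) := by
    rw [← rpow_natCast, ← rpow_sub hr, ← rpow_sub hr, ← rpow_add hr]
    congr 1
    push_cast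
    linear_combination -hcb
  rw [e1, e2]
  linear_combination |deriv G ρ| ^ p * ρ ^ (m + 2) * c ^ (p - 1) * c * e3

lemma integral_profile (hR : 0 < R) (hc : 0 < c)
    (hFG : ∀ r, 0 < r → F r = G (expScale R c r)) (hp : p = m + 2)
    (hcb : c * (b - 1) = n + 2 - p - β) :
    c * ∫ r in Ioi (0 : ℝ), r ^ (n + 1) * (|F r| ^ p / r ^ (p + β)) =
      ∫ ρ in Ioo 0 R, ρ ^ (m + 1) * (|G ρ| ^ p / (ρ ^ p * log (R / ρ) ^ b)) := by
  rw [integral_Ioo_eq_integral_expScale hR hc, ← integral_const_mul]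
  refine setIntegral_congr_fun measurableSet_Ioi fun r hr => ?_
  have hr : 0 < r := hr
  have hρ := expScale_pos (c := c) hR r
  rw [hFG r hr, log_div_expScale hR, ← rpow_mul hr.le]
  generalize expScale R c r = ρ at *
  have e1 : ρ ^ p = ρ ^ (m + 2) := by
    rw [hp, ← rpow_natCast]; push_cast; rfl
  have e3 : r ^ (n + 1) / r ^ (p + β) = r ^ (-c - 1) / r ^ (-c * b) := by
    rw [← rpow_natCast, ← rpow_sub hr, ← rpow_sub hr]
    congr 1
    push_cast
    linear_combination -hcb
  have e4 : ρ * ρ ^ (m + 1) / ρ ^ (m + 2) = 1 := by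
    rw [← pow_succ', div_self (by positivity)]
  rw [e1, mul_comm (ρ ^ (m + 2)), ← div_div]
  linear_combination c * |G ρ| ^ p * e3 - c * |G ρ| ^ p * (r ^ (-c - 1) / r ^ (-c * b)) * e4

end Profiles

lemma integral_polar_ball {n : ℕ} (m : ℕ) (hn : 1 ≤ n) {R : ℝ} {h : ℝ → ℝ} (hh : Measurable h)
    (h0 : ∀ r, 0 ≤ r → r < R → 0 ≤ h r) :
    ∫ z in {z : GPt n | gNorm z < R}, gPsi z ^ (((m : ℝ) + 2) / 2) * h (gNorm z) =
      COmega n m / 2 * ∫ r in Ioo 0 R, r ^ (n + 1) * h r := by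
  have hpolar := integral_polar (n := n) m hn (hh.indicator (measurableSet_Iio (a := R)))
    fun r hr => indicator_apply_nonneg fun hrR => h0 r hr hrR
  rw [← integral_indicator (isOpen_lt continuous_gNorm continuous_const).measurableSet,
    ← Ioi_inter_Iio, ← setIntegral_indicator measurableSet_Iio]
  refine Eq.trans (integral_congr_ae (.of_forall fun z => ?_)) (hpolar.trans ?_)
  · by_cases hz : gNorm z < R <;> simp [indicator, hz]
  · congr 2 with r
    by_cases hr : r < R <;> simp [indicator, hr]

lemma radialHardyIdentity_of_profiles {n m : ℕ} (hn : 1 ≤ n) (hm : 1 ≤ m) {Q Q' R β b : ℝ}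
    (hQ : Q = n + 2) (hQ' : Q' = m + 2) (hR : 0 < R) (hβ : β < Q - Q') (hb : 1 < b)
    {K L : Set ℝ} {F G : ℝ → ℝ} (hF : IsProfile K F) (hK : K ⊆ Ioi 0) (hG : IsProfile L G)
    (hL : L ⊆ Ioo 0 R)
    (hFG : ∀ r, 0 < r → F r = G (expScale R ((Q - Q' - β) / (b - 1)) r)) :
    radialHardyIdentity n m Q Q' R β b (fun z => F (gNorm z)) (fun z => G (gNorm z)) := by
  have hb1 : 0 < b - 1 := by linarith
  have hα : 0 < Q - Q' - β := by linarith
  have hQ'0 : 0 < Q' := by rw [hQ']; positivity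
  set c := (Q - Q' - β) / (b - 1) with hcdef
  have hc : 0 < c := div_pos hα hb1
  have hcb : c * (b - 1) = n + 2 - Q' - β := by
    rw [hcdef, div_mul_cancel₀ _ hb1.ne', hQ]
  have hF0 : F =ᶠ[𝓝 0] 0 := hF.eventuallyEq_zero fun h => lt_irrefl (0 : ℝ) (hK h)
  have hG0 : G =ᶠ[𝓝 0] 0 := hG.eventuallyEq_zero fun h => lt_irrefl (0 : ℝ) (hL h).1
  have hFm : Measurable F := hF.contDiff.continuous.measurable
  have hGm : Measurable G := hG.contDiff.continuous.measurable
  have hlog : ∀ r, 0 ≤ r → r < R → 0 ≤ log (R / r) := fun r hr hrR => by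
    rcases hr.eq_or_lt with rfl | hr
    · simp
    · exact (log_div_pos ⟨hr, hrR⟩).le
  have hI1 := integral_polar (n := n) m hn (h := fun r => |deriv F r| ^ Q' / r ^ β)
    (by have := measurable_deriv F; fun_prop) fun r hr => by positivity
  have hI2 := integral_polar (n := n) m hn (h := fun r => |F r| ^ Q' / r ^ (Q' + β))
    (by fun_prop) fun r hr => by positivity
  have hJ1 := integral_polar_ball (n := m) m hm (R := R)
    (h := fun r => |deriv G r| ^ Q' / log (R / r) ^ (b - Q'))
    (by have := measurable_deriv G; fun_prop)
    fun r hr hrR => div_nonneg (by positivity) (rpow_nonneg (hlog r hr hrR) _)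
  have hJ2 := integral_polar_ball (n := m) m hm (R := R)
    (h := fun r => |G r| ^ Q' / (r ^ Q' * log (R / r) ^ b))
    (by fun_prop)
    fun r hr hrR => div_nonneg (by positivity)
      (mul_nonneg (rpow_nonneg hr _) (rpow_nonneg (hlog r hr hrR) _))
  rw [integral_deriv_profile hG hR hc hFG hQ' hcb] at hI1
  rw [← integral_profile hR hc hFG hQ' hcb] at hJ2
  rw [← hQ'] at hI1 hI2 hJ1 hJ2
  have hconst : ((Q - Q' - β) / Q') ^ Q' = c ^ (Q' - 1) * c * ((b - 1) / Q') ^ Q' := by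
    rw [← rpow_add_one hc.ne', sub_add_cancel, ← mul_rpow hc.le (by positivity), hcdef]
    congr 1
    field_simp
  have hC := (COmega_self_pos hm).ne'
  simp only [radialHardyIdentity, radialDeriv_comp_gNorm hF0, radialDeriv_comp_gNorm hG0]
  have hu : ∀ z : GPt n, |F (gNorm z)| ^ Q' * gPsi z ^ (Q' / 2) / gNorm z ^ (Q' + β) =
      gPsi z ^ (Q' / 2) * (|F (gNorm z)| ^ Q' / gNorm z ^ (Q' + β)) := fun z => by ring
  have hw : ∀ z : GPt m,
      |G (gNorm z)| ^ Q' * gPsi z ^ (Q' / 2) / (gNorm z ^ Q' * log (R / gNorm z) ^ b) =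
        gPsi z ^ (Q' / 2) * (|G (gNorm z)| ^ Q' / (gNorm z ^ Q' * log (R / gNorm z) ^ b)) :=
    fun z => by ring
  simp only [hu, hw]
  simp only [mul_div_assoc (gPsi _ ^ (Q' / 2))]
  rw [hI1, hI2, hJ1, hJ2, ← hcdef, hconst]
  field_simp

end

/-- equivalence of the subcritical and critical Hardy inequalities for radial
functions (Theorem 5.1 of the paper). -/
theorem radial_subcritical_critical_equivalence
    (n m : ℕ) (Q Q' : ℝ) (hQ : Q = n + 2) (hQ' : Q' = m + 2)
    (hQQ' : Q' < Q) (hQ'3 : 3 ≤ Q') (R : ℝ) (hR : 0 < R) (β b : ℝ)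
    (hβ : β < Q - Q') (hb : Q' ≤ b) :
    (∀ w : GPt m → ℝ, IsTest {z : GPt m | gNorm z < R ∧ z ≠ 0} w → IsRadial w →
      ∃ u : GPt n → ℝ, IsTest {z : GPt n | z ≠ 0} u ∧ IsRadial u ∧
        radialHardyIdentity n m Q Q' R β b u w)
    ∧ ∀ u : GPt n → ℝ, IsTest {z : GPt n | z ≠ 0} u → IsRadial u →
        ∃ w : GPt m → ℝ, IsTest {z : GPt m | gNorm z < R ∧ z ≠ 0} w ∧ IsRadial w ∧
          radialHardyIdentity n m Q Q' R β b u w := by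
  have hm : 1 ≤ m := by
    have : (1 : ℝ) ≤ m := by linarith
    exact_mod_cast this
  have hn : 1 ≤ n := by
    have : (1 : ℝ) ≤ n := by
      have : (1 : ℝ) ≤ m := by exact_mod_cast hm
      linarith
    exact_mod_cast this
  have hb1 : 1 < b := by linarith
  have hc : 0 < (Q - Q' - β) / (b - 1) := div_pos (by linarith) (by linarith)
  refine ⟨fun w hw hrad => ?_, fun u hu hrad => ?_⟩
  · obtain ⟨G, hG, rfl⟩ := exists_profile hm hw hrad (by simp)
    have hL : gNorm '' tsupport (fun z : GPt m => G (gNorm z)) ⊆ Set.Ioo 0 R := by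
      rintro _ ⟨z, hz, rfl⟩
      exact ⟨gNorm_pos (hw.2.2 hz).2, (hw.2.2 hz).1⟩
    obtain ⟨K, F, hK, hF, hFG⟩ := hG.exists_comp_expScale hL hR hc
    exact ⟨_, hF.isTest hK fun z hz => by rintro rfl; simpa [gNorm_eq_zero_iff.2] using hK hz,
      ⟨F, fun _ => rfl⟩, radialHardyIdentity_of_profiles hn hm hQ hQ' hR hβ hb1 hF hK hG hL hFG⟩
  · obtain ⟨F, hF, rfl⟩ := exists_profile hn hu hrad (by simp)
    have hK : gNorm '' tsupport (fun z : GPt n => F (gNorm z)) ⊆ Set.Ioi 0 := by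
      rintro _ ⟨z, hz, rfl⟩
      exact gNorm_pos (hu.2.2 hz)
    obtain ⟨L, G, hL, hG, hFG⟩ := hF.exists_comp_logScale hK hR hc
    exact ⟨_, hG.isTest (fun r hr => (hL hr).1) fun z hz =>
        ⟨(hL hz).2, by rintro rfl; simpa [gNorm_eq_zero_iff.2] using (hL hz).1⟩,
      ⟨G, fun _ => rfl⟩, radialHardyIdentity_of_profiles hn hm hQ hQ' hR hβ hb1 hF hK hG hL hFG⟩
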